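/- Let G be a countable simple graph and let (G,p) be a bar-joint framework in a finite-dimensional real normed space (X,‖·‖). If (G,p) is infinitesimally rigid, then every edge-complete tower in (G,p) has the flex cancellation property. -/

import Mathlib

open Asymptotics Filter Topology Set

open scoped Classical

noncomputable section

namespace RigidityPaper

variable {V X E : Type}

/-- `p` is a placement of the graph `G`: adjacent vertices are placed at distinct points. -/
def IsPlacement (G : SimpleGraph V) (p : V → X) : Prop :=
  ∀ ⦃v w⦄, G.Adj v w → p v ≠ p w

section NormedSpace

variable [NormedAddCommGroup X] [NormedSpace ℝ X]

/-- `u` is an infinitesimal flex of the framework `(G,p)` in the normed space `X`. -/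
def IsFlex (G : SimpleGraph V) (p u : V → X) : Prop :=
  ∀ ⦃v w⦄, G.Adj v w →
    (fun t : ℝ => ‖(p v + t • u v) - (p w + t • u w)‖ - ‖p v - p w‖)
      =o[𝓝 (0 : ℝ)] (fun t : ℝ => t)

/-- A continuous rigid motion of the normed space `X`. -/
def IsContRigidMotion (Γ : X → ℝ → X) : Prop :=
  (∀ t ∈ Icc (-1 : ℝ) 1, Isometry (fun x => Γ x t)) ∧
    (∀ x, ContinuousOn (Γ x) (Icc (-1 : ℝ) 1)) ∧ ∀ x, Γ x 0 = x

/-- An infinitesimal rigid motion of the normed space `X`. -/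
def IsInfRigidMotion (γ : X → X) : Prop :=
  ∃ Γ, IsContRigidMotion Γ ∧ ∀ x, HasDerivWithinAt (Γ x) (γ x) (Icc (-1 : ℝ) 1) 0

/-- `u` is a trivial (infinitesimal) flex on the vertex set `S`. -/
def IsTrivialOn (p : V → X) (S : Set V) (u : V → X) : Prop :=
  ∃ γ, IsInfRigidMotion γ ∧ ∀ v ∈ S, u v = γ (p v)

/-- The framework `(G,p)` is infinitesimally rigid. -/
def InfRigid (G : SimpleGraph V) (p : V → X) : Prop :=
  ∀ u, IsFlex G p u → IsTrivialOn p univ u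

end NormedSpace

/-- A tower of finite subgraphs of `G`. -/
structure Tower (G : SimpleGraph V) where
  seq : ℕ → G.Subgraph
  mono : ∀ k, seq k ≤ seq (k + 1)
  finite : ∀ k, (seq k).verts.Finite

variable {G : SimpleGraph V}

/-- A tower is vertex-complete if its vertex sets exhaust the vertices of `G`. -/
def VertexComplete (T : Tower G) : Prop := (⋃ k, (T.seq k).verts) = univ

/-- A tower is edge-complete if its edges exhaust the edges of `G`. -/
def EdgeComplete (T : Tower G) : Prop := ∀ ⦃v w⦄, G.Adj v w → ∃ k, (T.seq k).Adj v w

section NormedSpace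

variable [NormedAddCommGroup X] [NormedSpace ℝ X]

/-- The flex cancellation property of a tower of frameworks: every non-trivial
infinitesimal flex of the `k`-th framework fails to extend to some later framework. -/
def FlexCancel (T : Tower G) (p : V → X) : Prop :=
  ∀ k u, IsFlex (T.seq k).spanningCoe p u → ¬ IsTrivialOn p (T.seq k).verts u →
    ∃ m, k < m ∧
      ¬ ∃ u', IsFlex (T.seq m).spanningCoe p u' ∧ ∀ v ∈ (T.seq k).verts, u' v = u v

/-- A tower of frameworks is relatively infinitesimally rigid: no non-trivial
infinitesimal flex of the `k`-th framework extends to the `(k+1)`-st framework. -/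
def RelRigidTower (T : Tower G) (p : V → X) : Prop :=
  ∀ k u, IsFlex (T.seq k).spanningCoe p u →
    (∃ u', IsFlex (T.seq (k + 1)).spanningCoe p u' ∧ ∀ v ∈ (T.seq k).verts, u' v = u v) →
    IsTrivialOn p (T.seq k).verts u

/-- The subframework on the subgraph `H` is infinitesimally rigid. -/
def SubInfRigid (H : G.Subgraph) (p : V → X) : Prop :=
  ∀ u, IsFlex H.spanningCoe p u → IsTrivialOn p H.verts u

/-- The framework `(G,p)` is sequentially infinitesimally rigid. -/
def SeqInfRigid (G : SimpleGraph V) (p : V → X) : Prop :=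
  ∃ T : Tower G, VertexComplete T ∧ ∀ k, SubInfRigid (T.seq k) p

end NormedSpace

/-! ### The `ℓ^q` norms on `ℝ^d` -/

/-- The `ℓ^q` norm on `ℝ^d`. -/
def qnorm (q : ℝ) {d : ℕ} (x : Fin d → ℝ) : ℝ := (∑ i, |x i| ^ q) ^ (1 / q)

/-- `u` is an infinitesimal flex of `(G,p)` in `(ℝ^d, ‖·‖_q)`. -/
def IsQFlex (q : ℝ) {d : ℕ} (G : SimpleGraph V) (p u : V → Fin d → ℝ) : Prop :=
  ∀ ⦃v w⦄, G.Adj v w →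
    (fun t : ℝ => qnorm q ((p v + t • u v) - (p w + t • u w)) - qnorm q (p v - p w))
      =o[𝓝 (0 : ℝ)] (fun t : ℝ => t)

/-- A continuous rigid motion of `(ℝ^d, ‖·‖_q)`. -/
def IsQContRigidMotion (q : ℝ) {d : ℕ} (Γ : (Fin d → ℝ) → ℝ → Fin d → ℝ) : Prop :=
  (∀ t ∈ Icc (-1 : ℝ) 1, ∀ x y, qnorm q (Γ x t - Γ y t) = qnorm q (x - y)) ∧
    (∀ x, ContinuousOn (Γ x) (Icc (-1 : ℝ) 1)) ∧ ∀ x, Γ x 0 = x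

/-- An infinitesimal rigid motion of `(ℝ^d, ‖·‖_q)`. -/
def IsQInfRigidMotion (q : ℝ) {d : ℕ} (γ : (Fin d → ℝ) → Fin d → ℝ) : Prop :=
  ∃ Γ, IsQContRigidMotion q Γ ∧ ∀ x, HasDerivWithinAt (Γ x) (γ x) (Icc (-1 : ℝ) 1) 0

/-- `u` is a trivial flex on the vertex set `S`, for the `ℓ^q` norm. -/
def IsQTrivialOn (q : ℝ) {d : ℕ} (p : V → Fin d → ℝ) (S : Set V) (u : V → Fin d → ℝ) : Prop :=
  ∃ γ, IsQInfRigidMotion q γ ∧ ∀ v ∈ S, u v = γ (p v)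

/-- The framework `(G,p)` is infinitesimally rigid in `(ℝ^d, ‖·‖_q)`. -/
def QInfRigid (q : ℝ) {d : ℕ} (G : SimpleGraph V) (p : V → Fin d → ℝ) : Prop :=
  ∀ u, IsQFlex q G p u → IsQTrivialOn q p univ u

/-- The subframework on the subgraph `H` is infinitesimally rigid in `(ℝ^d, ‖·‖_q)`. -/
def QSubInfRigid (q : ℝ) {d : ℕ} (H : G.Subgraph) (p : V → Fin d → ℝ) : Prop :=
  ∀ u, IsQFlex q H.spanningCoe p u → IsQTrivialOn q p H.verts u

/-! ### The rigidity matrix, regular and generic placements -/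

/-- The entry `sgn(a-b)|a-b|^{q-1}` of the rigidity matrix. -/
def rigidityCoef (q : ℝ) (a b : ℝ) : ℝ := Real.sign (a - b) * |a - b| ^ (q - 1)

/-- The row of the rigidity matrix `R_q(G,p)` corresponding to the (oriented) edge `vw`,
regarded as a vector in `ℝ^{V × d}`. -/
def rigidityRow (q : ℝ) {d : ℕ} (p : V → Fin d → ℝ) (v w : V) : V × Fin d → ℝ :=
  fun x =>
    (if x.1 = v then rigidityCoef q (p v x.2) (p w x.2) else 0) -
      (if x.1 = w then rigidityCoef q (p v x.2) (p w x.2) else 0)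

/-- The rank of the rigidity matrix `R_q(G,p)`, i.e. the dimension of its row space. -/
def rigidityRank (q : ℝ) {d : ℕ} (G : SimpleGraph V) (p : V → Fin d → ℝ) : ℕ :=
  Module.finrank ℝ
    (Submodule.span ℝ {r : V × Fin d → ℝ | ∃ v w, G.Adj v w ∧ r = rigidityRow q p v w})

/-- `(G,p)` is a regular framework in `(ℝ^d, ‖·‖_q)`: the rank of the rigidity matrix is
maximal at `p` over all placements of `G`. -/
def IsRegular (q : ℝ) {d : ℕ} (G : SimpleGraph V) (p : V → Fin d → ℝ) : Prop :=
  IsPlacement G p ∧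
    ∀ x : V → Fin d → ℝ, IsPlacement G x → rigidityRank q G x ≤ rigidityRank q G p

/-- `p` restricts on `W` to a generic placement: it is injective on `W` (a placement of the
complete graph on `W`) and every subframework of the complete graph on `W` is regular. -/
def GenericOn (q : ℝ) {d : ℕ} (p : V → Fin d → ℝ) (W : Set V) : Prop :=
  InjOn p W ∧ ∀ W' : Set V, W' ⊆ W → ∀ H : SimpleGraph W', IsRegular q H (fun x : W' => p x.1)

/-- `p` is a generic placement in `(ℝ^d, ‖·‖_q)`: its restriction to every finite set of
vertices is generic. -/
def IsGeneric (q : ℝ) {d : ℕ} (p : V → Fin d → ℝ) : Prop :=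
  ∀ W : Set V, W.Finite → GenericOn q p W

/-- The graph `G` is rigid in `(ℝ^d, ‖·‖_q)`: every generic placement is infinitesimally
rigid. -/
def Rigid (q : ℝ) (d : ℕ) (G : SimpleGraph V) : Prop :=
  ∀ p : V → Fin d → ℝ, IsGeneric q p → QInfRigid q G p

/-- The graph `G` is sequentially rigid in `(ℝ^d, ‖·‖_q)`: every generic placement is
sequentially infinitesimally rigid. -/
def SeqRigid (q : ℝ) (d : ℕ) (G : SimpleGraph V) : Prop :=
  ∀ p : V → Fin d → ℝ, IsGeneric q p →
    ∃ T : Tower G, VertexComplete T ∧ ∀ k, QSubInfRigid q (T.seq k) p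

/-- The graph `G` is minimally rigid in `(ℝ^d, ‖·‖_q)`. -/
def MinRigid (q : ℝ) (d : ℕ) (G : SimpleGraph V) : Prop :=
  Rigid q d G ∧
    ∀ p : V → Fin d → ℝ, IsGeneric q p → ∀ ⦃v w⦄, G.Adj v w →
      ¬ QInfRigid q (G.deleteEdges {s(v, w)}) p

/-! ### Continuous rigidity in `(ℝ^d, ‖·‖_q)` -/

/-- `α` is a continuous flex of `(G,p)` in `(ℝ^d, ‖·‖_q)`. -/
def IsQContFlex (q : ℝ) {d : ℕ} (G : SimpleGraph V) (p : V → Fin d → ℝ)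
    (α : V → ℝ → Fin d → ℝ) : Prop :=
  (∀ v, ContinuousOn (α v) (Icc (-1 : ℝ) 1)) ∧ (∀ v, α v 0 = p v) ∧
    ∀ ⦃v w⦄, G.Adj v w → ∀ t ∈ Icc (-1 : ℝ) 1, qnorm q (α v t - α w t) = qnorm q (p v - p w)

/-- `(G,p)` is continuously rigid in `(ℝ^d, ‖·‖_q)`: every continuous flex is trivial,
that is, derived from a continuous rigid motion. -/
def QContRigid (q : ℝ) {d : ℕ} (G : SimpleGraph V) (p : V → Fin d → ℝ) : Prop :=
  ∀ α, IsQContFlex q G p α →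
    ∃ Γ, IsQContRigidMotion q Γ ∧ ∀ v, ∀ t ∈ Icc (-1 : ℝ) 1, α v t = Γ (p v) t

/-! ### Sparsity counts -/

/-- A subgraph `H` is `(k,l)`-sparse. -/
def SubSparse (k l : ℕ) (H : G.Subgraph) : Prop :=
  ∀ H' : G.Subgraph, H' ≤ H → 2 ≤ H'.verts.ncard →
    (H'.edgeSet.ncard : ℤ) ≤ (k * H'.verts.ncard : ℤ) - l

/-- A subgraph `H` is `(k,l)`-tight. -/
def SubTight (k l : ℕ) (H : G.Subgraph) : Prop :=
  SubSparse k l H ∧ (H.edgeSet.ncard : ℤ) = (k * H.verts.ncard : ℤ) - l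

/-- A simple graph `G` (on its whole vertex type) is `(k,l)`-sparse. -/
def GraphSparse (k l : ℕ) (G : SimpleGraph V) : Prop :=
  ∀ H : G.Subgraph, 2 ≤ H.verts.ncard →
    (H.edgeSet.ncard : ℤ) ≤ (k * H.verts.ncard : ℤ) - l

/-! ### Graph moves -/

/-- Henneberg vertex extension move of degree 2: adjoin a new vertex `v` together with
edges to two distinct existing vertices. -/
def HennVertexMove (H H' : (⊤ : SimpleGraph V).Subgraph) : Prop :=
  ∃ v v₁ v₂, v ∉ H.verts ∧ v₁ ∈ H.verts ∧ v₂ ∈ H.verts ∧ v₁ ≠ v₂ ∧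
    H'.verts = insert v H.verts ∧
    ∀ a b, H'.Adj a b ↔
      (H.Adj a b ∨ (a = v ∧ (b = v₁ ∨ b = v₂)) ∨ (b = v ∧ (a = v₁ ∨ a = v₂)))

/-- Henneberg edge move of degree 2: remove an edge `v₁v₂` and adjoin a new vertex `v`
together with edges to `v₁`, `v₂` and a third existing vertex `v₃`. -/
def HennEdgeMove (H H' : (⊤ : SimpleGraph V).Subgraph) : Prop :=
  ∃ v v₁ v₂ v₃, v ∉ H.verts ∧ v₁ ∈ H.verts ∧ v₂ ∈ H.verts ∧ v₃ ∈ H.verts ∧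
    H.Adj v₁ v₂ ∧ v₃ ≠ v₁ ∧ v₃ ≠ v₂ ∧
    H'.verts = insert v H.verts ∧
    ∀ a b, H'.Adj a b ↔
      ((H.Adj a b ∧ ¬((a = v₁ ∧ b = v₂) ∨ (a = v₂ ∧ b = v₁))) ∨
        (a = v ∧ (b = v₁ ∨ b = v₂ ∨ b = v₃)) ∨ (b = v ∧ (a = v₁ ∨ a = v₂ ∨ a = v₃)))

/-- Vertex-to-`K₄` move: a vertex `w₀` is chosen, three new vertices `w₁,w₂,w₃` are
adjoined together with all edges among `{w₀,w₁,w₂,w₃}`, and every edge `xw₀` is either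
kept or replaced by an edge `x(f x)` with `f x ∈ {w₀,w₁,w₂,w₃}`. -/
def VertexToK4Move (H H' : (⊤ : SimpleGraph V).Subgraph) : Prop :=
  ∃ w₀ w₁ w₂ w₃, w₀ ∈ H.verts ∧ w₁ ∉ H.verts ∧ w₂ ∉ H.verts ∧ w₃ ∉ H.verts ∧
    w₁ ≠ w₂ ∧ w₁ ≠ w₃ ∧ w₂ ≠ w₃ ∧
    ∃ f : V → V, (∀ x, f x = w₀ ∨ f x = w₁ ∨ f x = w₂ ∨ f x = w₃) ∧
      H'.verts = insert w₁ (insert w₂ (insert w₃ H.verts)) ∧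
      ∀ a b, H'.Adj a b ↔
        ((H.Adj a b ∧ a ≠ w₀ ∧ b ≠ w₀) ∨
          (∃ x, H.Adj x w₀ ∧ ((a = x ∧ b = f x) ∨ (b = x ∧ a = f x))) ∨
          (a ∈ ({w₀, w₁, w₂, w₃} : Set V) ∧ b ∈ ({w₀, w₁, w₂, w₃} : Set V) ∧ a ≠ b))

/-- Vertex-to-4-cycle move: a vertex `v` with neighbours `v₁,v₂` is chosen, a new vertex
`v₀` is adjoined together with the edges `v₀v₁`, `v₀v₂`, and every other edge `vw` is
either kept or replaced by the edge `v₀w`. -/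
def VertexTo4CycleMove (H H' : (⊤ : SimpleGraph V).Subgraph) : Prop :=
  ∃ v v₀ v₁ v₂, v ∈ H.verts ∧ v₀ ∉ H.verts ∧ v₁ ≠ v₂ ∧
    H.Adj v v₁ ∧ H.Adj v v₂ ∧
    ∃ f : V → V, (∀ x, f x = v ∨ f x = v₀) ∧
      H'.verts = insert v₀ H.verts ∧
      ∀ a b, H'.Adj a b ↔
        ((H.Adj a b ∧ a ≠ v ∧ b ≠ v) ∨
          ((a = v ∨ a = v₀) ∧ (b = v₁ ∨ b = v₂)) ∨
          ((b = v ∨ b = v₀) ∧ (a = v₁ ∨ a = v₂)) ∨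
          (∃ w, H.Adj v w ∧ w ≠ v₁ ∧ w ≠ v₂ ∧ ((a = f w ∧ b = w) ∨ (b = f w ∧ a = w))))

/-! ### Multigraphs -/

/-- `(V',E')` is a subgraph of the multigraph with edge-endpoint map `ends`. -/
def MGSubgraph (ends : E → Sym2 V) (V' : Set V) (E' : Set E) : Prop :=
  ∀ e ∈ E', ∀ v ∈ ends e, v ∈ V'

/-- The (multigraph) subgraph `(V',E')` is `(k,l)`-sparse. -/
def MGSparseOn (k l : ℕ) (ends : E → Sym2 V) (V' : Set V) (E' : Set E) : Prop :=
  ∀ (V'' : Set V) (E'' : Set E), V'' ⊆ V' → E'' ⊆ E' → MGSubgraph ends V'' E'' →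
    2 ≤ V''.ncard → (E''.ncard : ℤ) ≤ (k * V''.ncard : ℤ) - l

/-- The (multigraph) subgraph `(V',E')` is `(k,l)`-tight. -/
def MGTightOn (k l : ℕ) (ends : E → Sym2 V) (V' : Set V) (E' : Set E) : Prop :=
  MGSparseOn k l ends V' E' ∧ (E'.ncard : ℤ) = (k * V'.ncard : ℤ) - l

/-- The degree of a vertex in a loopless multigraph. -/
def mgDeg (ends : E → Sym2 V) (v : V) : ℕ := {e | v ∈ ends e}.ncard

theorem aux_smul {X : Type} [NormedAddCommGroup X] [NormedSpace ℝ X] {g : ℝ → ℝ}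
    (hg : g =o[𝓝 (0 : ℝ)] (fun t : ℝ => t)) (c : ℝ) :
    (fun t => g (c * t)) =o[𝓝 (0 : ℝ)] (fun t : ℝ => t) := by
  have ht : Tendsto (fun t : ℝ => c * t) (𝓝 0) (𝓝 0) := by
    have : Continuous (fun t : ℝ => c * t) := by fun_prop
    simpa using this.tendsto 0
  exact (hg.comp_tendsto ht).trans_isBigO (isBigO_const_mul_self c _ _)

/-- directions in which the norm is stationary at `x` -/
def flexDir {X : Type} [NormedAddCommGroup X] [NormedSpace ℝ X] (x : X) : Submodule ℝ X where
  carrier := {d | (fun t : ℝ => ‖x + t • d‖ - ‖x‖) =o[𝓝 (0 : ℝ)] (fun t : ℝ => t)}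
  zero_mem' := by simp
  smul_mem' := by
    intro c d hd
    have := aux_smul (X := X) hd c
    simp only [Set.mem_ofPred_eq] at *
    refine this.congr_left ?_
    intro t
    simp only [smul_smul, mul_comm]
  add_mem' := by
    intro d e hd he
    have h2 : (fun t : ℝ => (1/2 : ℝ) * ((‖x + (2 * t) • d‖ - ‖x‖) + (‖x + (2 * t) • e‖ - ‖x‖)))
        =o[𝓝 (0 : ℝ)] (fun t : ℝ => t) :=
      ((aux_smul (X := X) hd 2).add (aux_smul (X := X) he 2)).const_mul_left _
    have h3 := aux_smul (X := X) h2 (-1)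
    have h4 := h2.norm_left.add h3.norm_left
    have up : ∀ t : ℝ, ‖x + t • (d + e)‖ ≤ (1/2) * (‖x + (2 * t) • d‖ + ‖x + (2 * t) • e‖) := by
      intro t
      have : x + t • (d + e) = (1/2 : ℝ) • ((x + (2 * t) • d) + (x + (2 * t) • e)) := by module
      rw [this, norm_smul]
      have := norm_add_le (x + (2 * t) • d) (x + (2 * t) • e)
      norm_num
      linarith
    have lo : ∀ t : ℝ, ‖x‖ ≤ (1/2) * (‖x + t • (d + e)‖ + ‖x + (-1 * t) • (d + e)‖) := by
      intro t
      have h : x = (1/2 : ℝ) • ((x + t • (d + e)) + (x + (-1 * t) • (d + e))) := by module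
      have h5 := norm_add_le (x + t • (d + e)) (x + (-1 * t) • (d + e))
      have h6 : ‖x‖ = (1/2) * ‖(x + t • (d + e)) + (x + (-1 * t) • (d + e))‖ := by
        conv_lhs => rw [h, norm_smul]
        norm_num
      linarith
    refine IsBigO.trans_isLittleO (IsBigO.of_bound 1 (Eventually.of_forall fun t => ?_)) h4
    have a1 := up t
    have a2 := up (-1 * t)
    have a3 := lo t
    simp only [Real.norm_eq_abs, one_mul]
    refine le_trans ?_ (le_abs_self _)
    have b1 := le_abs_self (1/2 * ((‖x + (2 * t) • d‖ - ‖x‖) + (‖x + (2 * t) • e‖ - ‖x‖)))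
    have b2 := le_abs_self
      (1/2 * ((‖x + (2 * (-1 * t)) • d‖ - ‖x‖) + (‖x + (2 * (-1 * t)) • e‖ - ‖x‖)))
    have c1 := abs_nonneg (1/2 * ((‖x + (2 * t) • d‖ - ‖x‖) + (‖x + (2 * t) • e‖ - ‖x‖)))
    have c2 := abs_nonneg
      (1/2 * ((‖x + (2 * (-1 * t)) • d‖ - ‖x‖) + (‖x + (2 * (-1 * t)) • e‖ - ‖x‖)))
    rw [abs_le]
    constructor <;> linarith

theorem isFlex_iff {V X : Type} [NormedAddCommGroup X] [NormedSpace ℝ X]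
    (G : SimpleGraph V) (p u : V → X) :
    IsFlex G p u ↔ ∀ ⦃v w⦄, G.Adj v w → u v - u w ∈ flexDir (p v - p w) := by
  unfold IsFlex
  refine forall_congr' fun v => forall_congr' fun w => imp_congr_right fun _ => ?_
  have : ∀ t : ℝ, (p v + t • u v) - (p w + t • u w) = p v - p w + t • (u v - u w) := by
    intro t; module
  simp only [this]
  rfl

/-- evaluation of finitely supported covectors -/
def evw {V X : Type} [NormedAddCommGroup X] [NormedSpace ℝ X] (u : V → X) :
    (V →₀ Module.Dual ℝ X) →ₗ[ℝ] ℝ :=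
  Finsupp.lsum ℝ (fun v => Module.Dual.eval ℝ X (u v))

theorem evw_single {V X : Type} [NormedAddCommGroup X] [NormedSpace ℝ X] (u : V → X) (v : V)
    (f : Module.Dual ℝ X) : evw u (Finsupp.single v f) = f (u v) := by
  rw [evw, Finsupp.lsum_single, Module.Dual.eval_apply]

/-- affine relations satisfied by a set of maps -/
def relSub {V X : Type} [NormedAddCommGroup X] [NormedSpace ℝ X] (S : Set (V → X)) :
    Submodule ℝ ((V →₀ Module.Dual ℝ X) × ℝ) where
  carrier := {q | ∀ u ∈ S, evw u q.1 = q.2}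
  zero_mem' := by simp
  add_mem' := by
    intro a b ha hb u hu
    simp [ha u hu, hb u hu]
  smul_mem' := by
    intro c a ha u hu
    simp [ha u hu]

theorem exists_limit {V X : Type} [NormedAddCommGroup X] [NormedSpace ℝ X]
    [FiniteDimensional ℝ X] (S : ℕ → Set (V → X)) (hS : Antitone S) (hne : ∀ m, (S m).Nonempty) :
    ∃ w : V → X, ∀ m, ∀ q ∈ relSub (S m), evw w q.1 = q.2 := by
  have hmono : Monotone fun m => relSub (S m) := fun m n hmn q hq u hu => hq u (hS hmn hu)
  have hz : ∀ q ∈ ⨆ m, relSub (S m), q.1 = 0 → q.2 = 0 := by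
    intro q hq h0
    obtain ⟨m, hm⟩ := (Submodule.mem_iSup_of_directed _ hmono.directed_le).1 hq
    obtain ⟨u, hu⟩ := hne m
    have := hm u hu
    rw [h0, map_zero] at this
    exact this.symm
  set F := Submodule.toLinearPMap (R := ℝ) (E := V →₀ Module.Dual ℝ X) (F := ℝ)
    (⨆ m, relSub (S m)) with hF
  have hg : F.graph = ⨆ m, relSub (S m) := Submodule.toLinearPMap_graph_eq _ hz
  obtain ⟨φ, hφ⟩ := LinearMap.exists_extend (K := ℝ) (V := V →₀ Module.Dual ℝ X) (V' := ℝ)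
    (p := F.domain) F.toFun
  refine ⟨fun v => (Module.evalEquiv ℝ X).symm (φ ∘ₗ Finsupp.lsingle v), fun m q hq => ?_⟩
  have hw : evw (fun v => (Module.evalEquiv ℝ X).symm (φ ∘ₗ Finsupp.lsingle v)) = φ := by
    refine Finsupp.lhom_ext fun v f => ?_
    rw [evw_single]
    rw [Module.apply_evalEquiv_symm_apply]
    simp
  rw [hw]
  have hq' : q ∈ F.graph := by
    rw [hg]
    exact Submodule.mem_iSup_of_mem m hq
  obtain ⟨y, hy1, hy2⟩ := (LinearPMap.mem_graph_iff F).1 hq'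
  rw [← hy1, ← hy2]
  exact LinearMap.congr_fun hφ y

theorem statement_16 {V X : Type} [Countable V] [NormedAddCommGroup X] [NormedSpace ℝ X]
    [FiniteDimensional ℝ X] (G : SimpleGraph V) (p : V → X) (hp : IsPlacement G p)
    (h : InfRigid G p) :
    ∀ T : Tower G, EdgeComplete T → FlexCancel T p := by
  intro T hT k u _ hnt
  by_contra! hcon
  have hTm : Monotone T.seq := monotone_nat_of_le_succ T.mono
  let S : ℕ → Set (V → X) := fun m =>
    {u' | IsFlex (T.seq (k + 1 + m)).spanningCoe p u' ∧ ∀ v ∈ (T.seq k).verts, u' v = u v}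
  have hS : Antitone S := by
    rintro m n hmn u' ⟨h1, h2⟩
    refine ⟨fun v w hvw => h1 ?_, h2⟩
    exact (hTm (show k + 1 + m ≤ k + 1 + n by omega)).2 hvw
  obtain ⟨w, hw⟩ := exists_limit S hS (fun m => hcon (k + 1 + m) (by omega))
  apply hnt
  have hagree : ∀ v ∈ (T.seq k).verts, w v = u v := by
    intro v hv
    rw [← sub_eq_zero, ← Module.forall_dual_apply_eq_zero_iff ℝ]
    intro f
    have := hw 0 (Finsupp.single v f, f (u v)) (fun u' hu' => by
      rw [evw_single, hu'.2 v hv])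
    rw [evw_single] at this
    rw [map_sub, this, sub_self]
  have hflex : IsFlex G p w := by
    rw [isFlex_iff]
    intro a b hab
    obtain ⟨j, hj⟩ := hT hab
    rw [← Subspace.forall_mem_dualAnnihilator_apply_eq_zero_iff]
    intro f hf
    have := hw j (Finsupp.single a f + Finsupp.single b (-f), 0) (fun u' hu' => by
      have h1 := (isFlex_iff _ _ _).1 hu'.1
        (show (T.seq (k + 1 + j)).spanningCoe.Adj a b from
          (hTm (show j ≤ k + 1 + j by omega)).2 hj)
      have h2 := (Submodule.mem_dualAnnihilator f).1 hf _ h1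
      rw [map_add, evw_single, evw_single, LinearMap.neg_apply, ← sub_eq_add_neg, ← map_sub]
      exact h2)
    rw [map_add, evw_single, evw_single, LinearMap.neg_apply, ← sub_eq_add_neg, ← map_sub] at this
    exact this
  obtain ⟨γ, hγ, hv⟩ := h w hflex
  exact ⟨γ, hγ, fun v hvk => by rw [← hagree v hvk, hv v (mem_univ v)]⟩

end RigidityPaper
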